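/- arXiv:1609.04477 — 9 statements merged into one kernel-verified Lean document; each statement's English description precedes it below -/
import Mathlib

section
/- Let A be a real symmetric n×n matrix, let x be a real number, and let D be a diagonal matrix congruent to A + xI (i.e., D = Pᵀ(A + xI)P for some invertible real matrix P). If D has k_+ positive diagonal entries, k_0 zero diagonal entries, and k_− negative diagonal entries, then: (i) A has exactly k_+ eigenvalues greater than −x (counted with multiplicity); (ii) A has exactly k_− eigenvalues less than −x; (iii) the multiplicity of −x as an eigenvalue of A is k_0. -/
open scoped Classical

theorem equiv_aux {n : ℕ} {d w : Fin n → ℝ} {Q : Matrix (Fin n) (Fin n) ℝ} (hQ : IsUnit Q)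
    (h : Matrix.diagonal d = Q.transpose * Matrix.diagonal w * Q) :
    QuadraticMap.Equivalent (QuadraticMap.weightedSumSquares ℝ d)
      (QuadraticMap.weightedSumSquares ℝ w) := by
  have := hQ.invertible
  refine ⟨⟨Matrix.toLin'OfInv (M := ⅟Q) (M' := Q) (by simp) (by simp), ?_⟩⟩
  intro v
  have key : ∀ (e u : Fin n → ℝ), QuadraticMap.weightedSumSquares ℝ e u
      = u ⬝ᵥ (Matrix.diagonal e).mulVec u := by
    intro e u
    simp only [QuadraticMap.weightedSumSquares_apply, dotProduct, Matrix.mulVec_diagonal,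
      smul_eq_mul]
    exact Finset.sum_congr rfl fun i _ => by ring
  change QuadraticMap.weightedSumSquares ℝ w (Q.mulVec v) = _
  rw [key, key, h, ← Matrix.mulVec_mulVec, ← Matrix.mulVec_mulVec,
    Matrix.dotProduct_mulVec v, Matrix.vecMul_transpose]

/-- Sylvester-type eigenvalue location: if `D` is a diagonal matrix congruent to
`A + xI` (with `A` real symmetric), and `D` has `kp` positive, `k0` zero and `km`
negative diagonal entries, then `A` has exactly `kp` eigenvalues greater than `-x`,
exactly `km` eigenvalues less than `-x`, and `-x` has multiplicity `k0`. -/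
theorem eigenvalue_location {n : ℕ} {A D P : Matrix (Fin n) (Fin n) ℝ} {x : ℝ}
    (hA : A.IsHermitian) (hD : D.IsDiag) (hP : IsUnit P)
    (hcong : D = P.transpose * (A + x • 1) * P)
    {kp k0 km : ℕ}
    (hkp : kp = (Finset.univ.filter fun i => 0 < D i i).card)
    (hk0 : k0 = (Finset.univ.filter fun i => D i i = 0).card)
    (hkm : km = (Finset.univ.filter fun i => D i i < 0).card) :
    (Finset.univ.filter fun i => -x < hA.eigenvalues i).card = kp ∧
    (Finset.univ.filter fun i => hA.eigenvalues i < -x).card = km ∧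
    (Finset.univ.filter fun i => hA.eigenvalues i = -x).card = k0 := by
  obtain ⟨U, hU1, hU2, hAU⟩ : ∃ U : Matrix (Fin n) (Fin n) ℝ, U * U.transpose = 1 ∧
      U.transpose * U = 1 ∧ A = U * Matrix.diagonal hA.eigenvalues * U.transpose := by
    refine ⟨hA.eigenvectorUnitary, ?_, ?_, ?_⟩
    · have := Unitary.coe_mul_star_self hA.eigenvectorUnitary
      simpa [Matrix.star_eq_conjTranspose] using this
    · have := Unitary.coe_star_mul_self hA.eigenvectorUnitary
      simpa [Matrix.star_eq_conjTranspose] using this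
    · have := hA.spectral_theorem
      rw [Unitary.conjStarAlgAut_apply] at this
      simpa [Matrix.star_eq_conjTranspose, Function.comp_def] using this
  set l := hA.eigenvalues with hl
  clear_value l
  have hQ : IsUnit (U.transpose * P) := (IsUnit.of_mul_eq_one U hU2).mul hP
  have hAx : A + x • 1 = U * Matrix.diagonal (fun i => l i + x) * U.transpose := by
    have : Matrix.diagonal (fun i => l i + x) = Matrix.diagonal l + x • 1 := by
      rw [Matrix.smul_one_eq_diagonal, Matrix.diagonal_add]
    rw [this, mul_add, add_mul, ← hAU]
    simp [hU1]
  have hE := equiv_aux (d := fun i => D i i) (w := fun i => l i + x) hQ (by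
    have : Matrix.diagonal (fun i => D i i) = D := hD.diagonal_diag
    rw [this, hcong, hAx]
    simp [Matrix.mul_assoc])
  have hp := QuadraticForm.sigPos_of_equiv_weightedSumSquares hE
  have hn := QuadraticForm.sigNeg_of_equiv_weightedSumSquares hE
  rw [QuadraticForm.sigPos_weightedSumSquares] at hp
  rw [QuadraticForm.sigNeg_weightedSumSquares] at hn
  simp only [Set.ncard_eq_toFinset_card', Set.toFinset_ofPred] at hp hn
  have e1 : ∀ i, -x < l i ↔ 0 < l i + x := fun i => by constructor <;> intro <;> linarith
  have e2 : ∀ i, l i < -x ↔ l i + x < 0 := fun i => by constructor <;> intro <;> linarith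
  have tot : ∀ (f : Fin n → ℝ) (c : ℝ), (Finset.univ.filter fun i => c < f i).card +
      (Finset.univ.filter fun i => f i < c).card +
      (Finset.univ.filter fun i => f i = c).card = n := by
    intro f c
    rw [← Finset.card_union_of_disjoint, ← Finset.card_union_of_disjoint]
    · convert Finset.card_fin n
      ext i
      simp only [Finset.mem_union, Finset.mem_filter, Finset.mem_univ, true_and, iff_true]
      rcases lt_trichotomy (f i) c with h | h | h <;> simp [h]
    · rw [Finset.disjoint_left]; intro i; simp; grind
    · rw [Finset.disjoint_left]; intro i; simp; grind
  have t1 := tot l (-x)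
  have t2 := tot (fun i => D i i) 0
  have g1 : (Finset.univ.filter fun i => -x < l i).card = kp := by
    rw [hkp]; simp only [e1]; convert hp.symm
  have g2 : (Finset.univ.filter fun i => l i < -x).card = km := by
    rw [hkm]; simp only [e2]; convert hn.symm
  refine ⟨g1, g2, ?_⟩
  simp only [← hkp, ← hkm, ← hk0] at t2
  omega
end

section
/- For a cograph G on n vertices, the multiplicity of 0 as an eigenvalue of the adjacency matrix equals n minus the number of distinct nonzero open neighborhoods, i.e., n_0(G) = n − |{ N(v) : v ∈ V(G), N(v) ≠ ∅ }|. Equivalently, the rank of the adjacency matrix of a cograph equals the number of distinct nonzero rows of the adjacency matrix. -/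
open scoped Classical

/-- A cograph is a finite simple graph with no induced path on four vertices. -/
def IsCograph {V : Type*} (G : SimpleGraph V) : Prop :=
  ¬ Nonempty (SimpleGraph.pathGraph 4 ↪g G)

def P4Free {V : Type*} (G : SimpleGraph V) : Prop :=
  ∀ a b c d, G.Adj a b → G.Adj b c → G.Adj c d → ¬ G.Adj a c → ¬ G.Adj b d → G.Adj a d

lemma P4Free.compl {V : Type*} {G : SimpleGraph V} (h : P4Free G) : P4Free Gᶜ := by
  intro a b c d hab hbc hcd hac hbd
  by_contra had
  have h1 : a ≠ c := by rintro rfl; exact had hcd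
  have h2 : b ≠ d := by rintro rfl; exact had hab
  have h3 : a ≠ d := by rintro rfl; exact hac hcd.symm
  simp only [SimpleGraph.compl_adj, not_and, not_not] at *
  have := h b d a c (hbd h2) (had h3).symm (hac h1) (fun h => hab.2 h.symm)
    (fun h => hcd.2 h.symm)
  exact hbc.2 this

lemma IsCograph.p4Free {V : Type*} {G : SimpleGraph V} (h : IsCograph G) : P4Free G := by
  intro a b c d hab hbc hcd hac hbd
  by_contra had
  apply h
  have h1 : a ≠ c := by rintro rfl; exact had hcd
  have h2 : b ≠ d := by rintro rfl; exact had hab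
  have h3 : a ≠ d := by rintro rfl; exact hac hcd.symm
  have e1 := hab.ne
  have e2 := hbc.ne
  have e3 := hcd.ne
  refine ⟨⟨⟨![a, b, c, d], ?_⟩, ?_⟩⟩
  · intro i j hij
    fin_cases i <;> fin_cases j <;> simp_all
  · intro i j
    have := hab.symm
    have := hbc.symm
    have := hcd.symm
    have : ¬ G.Adj c a := fun h => hac h.symm
    have : ¬ G.Adj d b := fun h => hbd h.symm
    have : ¬ G.Adj d a := fun h => had h.symm
    change G.Adj (![a, b, c, d] i) (![a, b, c, d] j) ↔ _
    fin_cases i <;> fin_cases j <;> simp_all [SimpleGraph.pathGraph_adj]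

/-- `S` splits as a nontrivial disjoint union. -/
def Splits' {V : Type*} (G : SimpleGraph V) (S : Finset V) : Prop :=
  ∃ A ⊆ S, A.Nonempty ∧ (S \ A).Nonempty ∧ ∀ a ∈ A, ∀ b ∈ S \ A, ¬ G.Adj a b

lemma split_step {V : Type*} {G : SimpleGraph V} (h : P4Free G) (S : Finset V) (v : V)
    (hv : v ∉ S) (hs : Splits' G S) : Splits' G (insert v S) ∨ Splits' Gᶜ (insert v S) := by
  by_cases hall : ∀ w ∈ S, G.Adj v w
  · right
    obtain ⟨A, hA, ⟨a, ha⟩, -⟩ := hs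
    refine ⟨{v}, by simp, by simp, ⟨a, ?_⟩, ?_⟩
    · have := hA ha
      simp only [Finset.mem_sdiff, Finset.mem_insert, Finset.mem_singleton]
      grind
    · intro x hx b hb
      simp only [Finset.mem_sdiff, Finset.mem_insert, Finset.mem_singleton] at hx hb
      subst hx
      simp only [SimpleGraph.compl_adj]
      grind
  push Not at hall
  obtain ⟨w, hw, hvw⟩ := hall
  left
  have hs' : ∃ A ⊆ S, w ∈ A ∧ (S \ A).Nonempty ∧ ∀ a ∈ A, ∀ b ∈ S \ A, ¬ G.Adj a b := by
    obtain ⟨A, hA, hne, hne2, hadj⟩ := hs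
    by_cases hwA : w ∈ A
    · exact ⟨A, hA, hwA, hne2, hadj⟩
    · refine ⟨S \ A, Finset.sdiff_subset, by simp [hw, hwA], by simpa [Finset.inter_eq_right.2 hA] using hne, ?_⟩
      intro a ha b hb hab
      exact hadj b (by simp at hb; exact hb.2) a ha hab.symm
  let F := S.powerset.filter
    (fun A => w ∈ A ∧ (S \ A).Nonempty ∧ ∀ a ∈ A, ∀ b ∈ S \ A, ¬ G.Adj a b)
  have hF : F.Nonempty := by
    obtain ⟨A, hA, h1⟩ := hs'
    exact ⟨A, by simp only [F, Finset.mem_filter, Finset.mem_powerset]; exact ⟨hA, h1⟩⟩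
  obtain ⟨C, hCF, hmin⟩ := Finset.exists_min_image F Finset.card hF
  simp only [F, Finset.mem_filter, Finset.mem_powerset] at hCF hmin
  obtain ⟨hCS, hwC, ⟨d0, hd0⟩, hC⟩ := hCF
  have hvC : v ∉ C := fun h => hv (hCS h)
  by_cases hN : ∃ a0 ∈ C, G.Adj v a0
  · obtain ⟨a0, ha0, hva0⟩ := hN
    by_cases hD : ∃ d ∈ S \ C, G.Adj v d
    · exfalso
      obtain ⟨d, hd, hvd⟩ := hD
      let C' := C.filter (fun z => ¬ G.Adj v z)
      have hlt : C'.card < C.card := by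
        apply Finset.card_lt_card
        refine (Finset.filter_ssubset).2 ⟨a0, ha0, by simpa using hva0⟩
      have hex : ∃ b ∈ C', ∃ a ∈ S \ C', G.Adj b a := by
        by_contra hcon
        push Not at hcon
        have := hmin C' ⟨(Finset.filter_subset _ _).trans hCS, by simp [C', hwC, hvw],
          ⟨d0, by simp [C'] at hd0 ⊢; grind⟩, hcon⟩
        omega
      obtain ⟨b, hb, a, ha, hba⟩ := hex
      simp only [C', Finset.mem_filter, Finset.mem_sdiff] at hb ha
      have haC : a ∈ C := by
        by_contra haC
        exact hC b hb.1 a (by simp [ha.1, haC]) hba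
      have hva : G.Adj v a := by
        by_contra hva
        exact ha.2 ⟨haC, hva⟩
      exact hC b hb.1 d hd (h b a v d hba hva.symm hvd (fun h => hb.2 h.symm) (hC a haC d hd))
    · push Not at hD
      refine ⟨S \ C, ?_, ⟨d0, hd0⟩, ⟨v, by simp [hv]⟩, ?_⟩
      · exact Finset.sdiff_subset.trans (Finset.subset_insert _ _)
      · intro a ha b hb hab
        have hb' : b = v ∨ b ∈ C := by simp at hb; grind
        rcases hb' with rfl | hb'
        · exact hD a ha hab.symm
        · exact hC b hb' a ha hab.symm
  · push Not at hN
    refine ⟨C, hCS.trans (Finset.subset_insert _ _), ⟨w, hwC⟩, ⟨v, by simp [hvC]⟩, ?_⟩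
    intro a ha b hb hab
    have hb' : b = v ∨ b ∈ S \ C := by simp at hb ⊢; grind
    rcases hb' with rfl | hb'
    · exact hN a ha hab.symm
    · exact hC a ha b hb' hab

lemma split_exists {V : Type*} {G : SimpleGraph V} (h : P4Free G) (S : Finset V)
    (hS : S.Nonempty) : (∃ v, S = {v}) ∨ Splits' G S ∨ Splits' Gᶜ S := by
  induction S using Finset.induction_on with
  | empty => simp at hS
  | insert v S hv ih =>
    rcases S.eq_empty_or_nonempty with rfl | hne
    · left; exact ⟨v, by simp⟩
    right
    rcases ih hne with ⟨u, rfl⟩ | h1 | h1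
    · have huv : v ≠ u := by simpa using hv
      by_cases hadj : G.Adj v u
      · right
        refine ⟨{v}, by simp, by simp, ⟨u, by simp [huv.symm]⟩, ?_⟩
        intro a ha b hb
        simp at ha hb
        have : b = u := by grind
        subst ha this
        simp [hadj]
      · left
        refine ⟨{v}, by simp, by simp, ⟨u, by simp [huv.symm]⟩, ?_⟩
        intro a ha b hb
        simp at ha hb
        have : b = u := by grind
        subst ha this
        exact hadj
    · exact split_step h S v hv h1
    · have := split_step h.compl S v hv h1
      rw [compl_compl] at this
      exact this.symm

lemma key {V : Type*} {G : SimpleGraph V} (h : P4Free G) (n : ℕ) :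
    ∀ (S : Finset V), S.card = n → S.Nonempty →
    (∀ u ∈ S, ∀ v ∈ S, (∀ w ∈ S, G.Adj u w ↔ G.Adj v w) → u = v) →
    ∀ (x : V → ℝ) (c : ℝ), (∀ u ∈ S, ∑ v ∈ S, (if G.Adj u v then x v else 0) = c) →
    ∃ t : ℝ, 0 ≤ t ∧ t < 1 ∧ c = t * ∑ v ∈ S, x v ∧ (∑ v ∈ S, x v = 0 → ∀ v ∈ S, x v = 0) ∧
      (c = 0 → (∀ v ∈ S, x v = 0) ∨ ∃ u ∈ S, ∀ w ∈ S, ¬ G.Adj u w) := by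
  induction n using Nat.strong_induction_on with
  | _ n ih =>
  intro S hcard hS hnd x c hx
  rcases split_exists h S hS with ⟨v, rfl⟩ | hsp | hsp
  · have := hx v (by simp)
    simp at this
    refine ⟨0, le_rfl, by norm_num, by simp [← this], by simp, fun _ => Or.inr ⟨v, by simp⟩⟩
  · obtain ⟨A, hAS, hA, hB, hAB⟩ := hsp
    set B := S \ A with hBdef
    have hmem : ∀ w, w ∈ S ↔ w ∈ A ∨ w ∈ B := by
      intro w; simp [hBdef]; grind
    have hBA : ∀ b ∈ B, ∀ a ∈ A, ¬ G.Adj b a := fun b hb a ha hab => hAB a ha b hb hab.symm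
    have hsum : ∀ f : V → ℝ, ∑ v ∈ S, f v = ∑ v ∈ A, f v + ∑ v ∈ B, f v := by
      intro f; rw [add_comm]; exact (Finset.sum_sdiff hAS).symm
    have hcA : A.card < n := by
      have := Finset.card_sdiff_add_card_eq_card hAS
      rw [← hBdef] at this
      have := hB.card_pos
      omega
    have hcB : B.card < n := by
      have := Finset.card_sdiff_add_card_eq_card hAS
      rw [← hBdef] at this
      have := hA.card_pos
      omega
    obtain ⟨t1, p1, q1, r1, s1, z1⟩ := ih _ hcA A rfl hA (by
      intro u hu v hv huv
      refine hnd u ((hmem u).2 (Or.inl hu)) v ((hmem v).2 (Or.inl hv)) fun w hw => ?_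
      rcases (hmem w).1 hw with hw | hw
      · exact huv w hw
      · simp [hAB u hu w hw, hAB v hv w hw]) x c (by
      intro u hu
      have := hx u ((hmem u).2 (Or.inl hu))
      rw [hsum, Finset.sum_eq_zero (s := B)] at this
      · simpa using this
      · intro w hw; simp [hAB u hu w hw])
    obtain ⟨t2, p2, q2, r2, s2, z2⟩ := ih _ hcB B rfl hB (by
      intro u hu v hv huv
      refine hnd u ((hmem u).2 (Or.inr hu)) v ((hmem v).2 (Or.inr hv)) fun w hw => ?_
      rcases (hmem w).1 hw with hw | hw
      · simp [hBA u hu w hw, hBA v hv w hw]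
      · exact huv w hw) x c (by
      intro u hu
      have := hx u ((hmem u).2 (Or.inr hu))
      rw [hsum, Finset.sum_eq_zero (s := A)] at this
      · simpa using this
      · intro w hw; simp [hBA u hu w hw])
    rw [hsum]
    by_cases hc : c = 0
    · have z1 := z1 hc
      have z2 := z2 hc
      have isoA : (∃ u ∈ A, ∀ w ∈ A, ¬ G.Adj u w) → ∃ u ∈ A, ∀ w ∈ S, ¬ G.Adj u w := by
        rintro ⟨u, hu, hw⟩
        refine ⟨u, hu, fun w hwS => ?_⟩
        rcases (hmem w).1 hwS with h | h
        · exact hw w h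
        · exact hAB u hu w h
      have isoB : (∃ u ∈ B, ∀ w ∈ B, ¬ G.Adj u w) → ∃ u ∈ B, ∀ w ∈ S, ¬ G.Adj u w := by
        rintro ⟨u, hu, hw⟩
        refine ⟨u, hu, fun w hwS => ?_⟩
        rcases (hmem w).1 hwS with h | h
        · exact hBA u hu w h
        · exact hw w h
      refine ⟨0, le_rfl, by norm_num, by simp [hc], ?_, ?_⟩
      · intro hs
        have hor : (∀ v ∈ A, x v = 0) ∨ (∀ v ∈ B, x v = 0) := by
          rcases z1 with z1 | z1
          · exact Or.inl z1
          rcases z2 with z2 | z2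
          · exact Or.inr z2
          exfalso
          obtain ⟨u, hu, hu'⟩ := isoA z1
          obtain ⟨v, hv, hv'⟩ := isoB z2
          have huv := hnd u ((hmem u).2 (Or.inl hu)) v ((hmem v).2 (Or.inr hv))
            (fun w hw => by simp [hu' w hw, hv' w hw])
          subst huv
          simp [hBdef] at hv
          exact hv.2 hu
        intro v hv
        rcases hor with h0 | h0
        · rw [Finset.sum_eq_zero h0, zero_add] at hs
          rcases (hmem v).1 hv with hv | hv
          · exact h0 v hv
          · exact s2 hs v hv
        · rw [Finset.sum_eq_zero h0, add_zero] at hs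
          rcases (hmem v).1 hv with hv | hv
          · exact s1 hs v hv
          · exact h0 v hv
      · intro _
        rcases z1 with z1 | z1
        · rcases z2 with z2 | z2
          · left
            intro v hv
            rcases (hmem v).1 hv with hv | hv
            · exact z1 v hv
            · exact z2 v hv
          · right
            obtain ⟨u, hu, hu'⟩ := isoB z2
            exact ⟨u, (hmem u).2 (Or.inr hu), hu'⟩
        · right
          obtain ⟨u, hu, hu'⟩ := isoA z1
          exact ⟨u, (hmem u).2 (Or.inl hu), hu'⟩
    · generalize ∑ v ∈ A, x v = a at *
      generalize ∑ v ∈ B, x v = b at *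
      have ht1 : 0 < t1 := lt_of_le_of_ne p1 (by rintro rfl; simp at r1; exact hc r1)
      have ht2 : 0 < t2 := lt_of_le_of_ne p2 (by rintro rfl; simp at r2; exact hc r2)
      have hpos : 0 < t1 + t2 := by positivity
      have heq : c = t1 * t2 / (t1 + t2) * (a + b) := by
        field_simp
        have : c * t2 = t1 * a * t2 := by rw [← r1]
        have : c * t1 = t2 * b * t1 := by rw [← r2]
        linarith
      refine ⟨t1 * t2 / (t1 + t2), by positivity, ?_, heq, ?_, fun h => absurd h hc⟩
      · rw [div_lt_one hpos]; nlinarith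
      · intro h0
        rw [h0, mul_zero] at heq
        exact absurd heq hc
  · obtain ⟨A, hAS, hA, hB, hAB'⟩ := hsp
    set B := S \ A with hBdef
    have hAB : ∀ a ∈ A, ∀ b ∈ B, G.Adj a b := by
      intro a ha b hb
      have h1 := hAB' a ha b hb
      have h2 : a ≠ b := by
        rintro rfl
        simp [hBdef] at hb
        exact hb.2 ha
      simp only [SimpleGraph.compl_adj, not_and, not_not] at h1
      exact h1 h2
    have hmem : ∀ w, w ∈ S ↔ w ∈ A ∨ w ∈ B := by
      intro w; simp [hBdef]; grind
    have hBA : ∀ b ∈ B, ∀ a ∈ A, G.Adj b a := fun b hb a ha => (hAB a ha b hb).symm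
    have hsum : ∀ f : V → ℝ, ∑ v ∈ S, f v = ∑ v ∈ A, f v + ∑ v ∈ B, f v := by
      intro f; rw [add_comm]; exact (Finset.sum_sdiff hAS).symm
    have hcA : A.card < n := by
      have := Finset.card_sdiff_add_card_eq_card hAS
      rw [← hBdef] at this
      have := hB.card_pos
      omega
    have hcB : B.card < n := by
      have := Finset.card_sdiff_add_card_eq_card hAS
      rw [← hBdef] at this
      have := hA.card_pos
      omega
    obtain ⟨t1, p1, q1, r1, s1, -⟩ := ih _ hcA A rfl hA (by
      intro u hu v hv huv
      refine hnd u ((hmem u).2 (Or.inl hu)) v ((hmem v).2 (Or.inl hv)) fun w hw => ?_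
      rcases (hmem w).1 hw with hw | hw
      · exact huv w hw
      · simp [hAB u hu w hw, hAB v hv w hw]) x (c - ∑ v ∈ B, x v) (by
      intro u hu
      have := hx u ((hmem u).2 (Or.inl hu))
      rw [hsum, Finset.sum_congr (s₁ := B) rfl (g := x)] at this
      · linarith
      · intro w hw; simp [hAB u hu w hw])
    obtain ⟨t2, p2, q2, r2, s2, -⟩ := ih _ hcB B rfl hB (by
      intro u hu v hv huv
      refine hnd u ((hmem u).2 (Or.inr hu)) v ((hmem v).2 (Or.inr hv)) fun w hw => ?_
      rcases (hmem w).1 hw with hw | hw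
      · simp [hBA u hu w hw, hBA v hv w hw]
      · exact huv w hw) x (c - ∑ v ∈ A, x v) (by
      intro u hu
      have := hx u ((hmem u).2 (Or.inr hu))
      rw [hsum, Finset.sum_congr (s₁ := A) rfl (g := x)] at this
      · linarith
      · intro w hw; simp [hBA u hu w hw])
    rw [hsum]
    generalize ∑ v ∈ A, x v = a at *
    generalize ∑ v ∈ B, x v = b at *
    have hpos : 0 < 2 - t1 - t2 := by linarith
    have hpos2 : 0 < 1 - t1 * t2 := by nlinarith
    have hk : (1 - t1) * a = (1 - t2) * b := by linarith
    have heq : c = (1 - t1 * t2) / (2 - t1 - t2) * (a + b) := by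
      rw [div_mul_eq_mul_div, eq_div_iff hpos.ne']
      have hc : c = b + t1 * a := by linarith
      rw [hc]
      linear_combination (t1 - 1) * hk
    have hz : a + b = 0 → ∀ v ∈ S, x v = 0 := by
      intro h0
      have hb : b = -a := by linarith
      have ha : a * (2 - t1 - t2) = 0 := by rw [hb] at hk; linarith
      have ha : a = 0 := by
        rcases mul_eq_zero.1 ha with h | h
        · exact h
        · exact absurd h hpos.ne'
      intro v hv
      rcases (hmem v).1 hv with hv | hv
      · exact s1 ha v hv
      · exact s2 (by linarith) v hv
    refine ⟨(1 - t1 * t2) / (2 - t1 - t2), by positivity, ?_, heq, hz, fun h0 => Or.inl ?_⟩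
    · rw [div_lt_one hpos]; nlinarith
    · rw [h0] at heq
      rcases mul_eq_zero.1 heq.symm with h | h
      · exact absurd h (by positivity)
      · exact hz h

lemma rank_eq {V : Type*} [Fintype V] (G : SimpleGraph V) (hG : IsCograph G) :
    (G.adjMatrix ℝ).rank =
      {row : V → ℝ | (∃ v, row = G.adjMatrix ℝ v) ∧ row ≠ 0}.ncard := by
  set R := {row : V → ℝ | (∃ v, row = G.adjMatrix ℝ v) ∧ row ≠ 0} with hR
  have hRR : R = Set.range (G.adjMatrix ℝ).row \ {0} := by
    ext r
    simp only [hR, Set.mem_setOf_eq, Set.mem_diff, Set.mem_range, Set.mem_singleton_iff]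
    exact and_congr_left fun _ => ⟨fun ⟨v, h⟩ => ⟨v, h.symm⟩, fun ⟨v, h⟩ => ⟨v, h.symm⟩⟩
  have hfin : R.Finite := by rw [hRR]; exact (Set.finite_range _).sdiff
  haveI : Fintype R := hfin.fintype
  have hli : LinearIndependent ℝ (Subtype.val : R → V → ℝ) := by
    choose g hg using fun r : R => r.2.1
    have hginj : Function.Injective g := by
      intro r s hrs
      apply Subtype.ext
      rw [hg r, hg s, hrs]
    rw [Fintype.linearIndependent_iff]
    intro y hy
    rcases isEmpty_or_nonempty R with he | hne
    · intro i; exact he.elim i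
    have hval : ∀ (r : R) (w : V), r.1 w = if G.Adj (g r) w then 1 else 0 := by
      intro r w
      rw [hg r, SimpleGraph.adjMatrix_apply]
    have hrep : ∀ w u : V, G.Adj w u → ∃ s : R, ∀ z, G.Adj (g s) z ↔ G.Adj w z := by
      intro w u hwu
      let s : R := ⟨G.adjMatrix ℝ w, ⟨w, rfl⟩, fun h0 => by
        have := congrFun h0 u
        simp [SimpleGraph.adjMatrix_apply, hwu] at this⟩
      refine ⟨s, fun z => ?_⟩
      have := hval s z
      simp only [s, SimpleGraph.adjMatrix_apply] at this
      by_cases h1 : G.Adj w z <;> by_cases h2 : G.Adj (g s) z <;> simp only [s] at h2 <;>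
        simp [h1, h2] at this ⊢ <;> assumption
    let S : Finset V := Finset.univ.image g
    let x : V → ℝ := Function.extend g y 0
    have hxg : ∀ r, x (g r) = y r := fun r => hginj.extend_apply _ _ _
    have hsumS : ∀ f : V → ℝ, ∑ v ∈ S, f v = ∑ r : R, f (g r) := by
      intro f
      exact Finset.sum_image (fun a _ b _ hab => hginj hab)
    obtain ⟨t, -, -, -, -, hz⟩ := key hG.p4Free S.card S rfl
      (Finset.univ_nonempty.image g) (by
        intro u hu v hv huv
        simp only [S, Finset.mem_image, Finset.mem_univ, true_and] at hu hv
        obtain ⟨r, rfl⟩ := hu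
        obtain ⟨s, rfl⟩ := hv
        congr 1
        apply Subtype.ext
        ext w
        rw [hval, hval]
        have : G.Adj (g r) w ↔ G.Adj (g s) w := by
          by_cases hw : ∃ u, G.Adj w u
          · obtain ⟨u, hu⟩ := hw
            obtain ⟨q, hq⟩ := hrep w u hu
            have := huv (g q) (by simp [S])
            rw [G.adj_comm (g r), G.adj_comm (g s), hq, hq] at this
            rw [G.adj_comm (g r), G.adj_comm (g s), this]
          · push Not at hw
            constructor
            · intro h; exact absurd h.symm (hw _)
            · intro h; exact absurd h.symm (hw _)
        simp [this]) x 0 (by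
        intro u hu
        rw [hsumS]
        have := congrFun hy u
        simp only [Finset.sum_apply, Pi.smul_apply, smul_eq_mul, Pi.zero_apply, hval] at this
        refine Eq.trans ?_ this
        refine Finset.sum_congr rfl fun r _ => ?_
        rw [hxg, G.adj_comm]
        simp)
    rcases hz rfl with hz | ⟨u, hu, hiso⟩
    · intro r
      rw [← hxg]
      exact hz _ (by simp [S])
    · exfalso
      simp only [S, Finset.mem_image, Finset.mem_univ, true_and] at hu
      obtain ⟨r, rfl⟩ := hu
      apply r.2.2
      ext w
      rw [hval]
      by_cases hw : G.Adj (g r) w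
      · exfalso
        obtain ⟨q, hq⟩ := hrep w _ hw.symm
        exact hiso (g q) (by simp [S]) ((hq _).2 hw.symm).symm
      · simp [hw]
  rw [Matrix.rank_eq_finrank_span_row, ← Submodule.span_sdiff_singleton_zero, ← hRR,
    finrank_span_set_eq_card hli, Set.ncard_eq_toFinset_card']

theorem cograph_nullity_and_rank {V : Type*} [Fintype V] (G : SimpleGraph V)
    (hG : IsCograph G) :
    Module.finrank ℝ (LinearMap.ker (Matrix.toLin' (G.adjMatrix ℝ))) =
      Fintype.card V - {S : Set V | (∃ v, S = G.neighborSet v) ∧ S ≠ ∅}.ncard ∧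
    (G.adjMatrix ℝ).rank =
      {row : V → ℝ | (∃ v, row = G.adjMatrix ℝ v) ∧ row ≠ 0}.ncard := by
  have hr := rank_eq G hG
  refine ⟨?_, hr⟩
  have hinj : Function.Injective (fun (S : Set V) (w : V) => if w ∈ S then (1 : ℝ) else 0) := by
    intro S T hST
    ext w
    have := congrFun hST w
    by_cases h1 : w ∈ S <;> by_cases h2 : w ∈ T <;> simp_all
  have hrow : ∀ v, (fun (S : Set V) (w : V) => if w ∈ S then (1 : ℝ) else 0) (G.neighborSet v)
      = G.adjMatrix ℝ v := by
    intro v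
    ext w
    simp [SimpleGraph.adjMatrix_apply]
  have h0 : (fun (S : Set V) (w : V) => if w ∈ S then (1 : ℝ) else 0) ∅ = 0 := by
    ext w; simp
  have hcard : {S : Set V | (∃ v, S = G.neighborSet v) ∧ S ≠ ∅}.ncard =
      {row : V → ℝ | (∃ v, row = G.adjMatrix ℝ v) ∧ row ≠ 0}.ncard := by
    rw [← Set.ncard_image_of_injective _ hinj]
    congr 1
    ext r
    constructor
    · rintro ⟨S, ⟨⟨v, rfl⟩, hne⟩, rfl⟩
      refine ⟨⟨v, hrow v⟩, fun h => hne (hinj (h.trans h0.symm))⟩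
    · rintro ⟨⟨v, rfl⟩, hne⟩
      refine ⟨G.neighborSet v, ⟨⟨v, rfl⟩, fun h => hne ?_⟩, hrow v⟩
      rw [← hrow v, h, h0]
  rw [hcard, ← hr]
  have := LinearMap.finrank_range_add_finrank_ker (Matrix.toLin' (G.adjMatrix ℝ))
  rw [Module.finrank_fintype_fun_eq_card] at this
  have h2 : (G.adjMatrix ℝ).rank
      = Module.finrank ℝ (LinearMap.range (Matrix.toLin' (G.adjMatrix ℝ))) := by
    rw [Matrix.rank, Matrix.toLin'_apply']
  omega
end

section
/- For every integer r ≥ 1, the graph G_r has inertia (r+1, 0, 2r+3): its adjacency matrix has exactly r+1 positive eigenvalues, no zero eigenvalue, and exactly 2r+3 negative eigenvalues (all counted with multiplicity). -/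
open scoped Classical

/-- The real adjacency matrix of a finite simple graph is Hermitian (symmetric). -/
theorem adjMatrix_isHermitian {V : Type*} [Fintype V] (G : SimpleGraph V)
    [DecidableRel G.Adj] : (G.adjMatrix ℝ).IsHermitian := by
  unfold Matrix.IsHermitian
  rw [Matrix.conjTranspose_eq_transpose_of_trivial]
  exact G.isSymm_adjMatrix

/-- `Gr r` is the join of `K_{r+2}` with the disjoint union of `r+1` copies of `K_2`:
two distinct vertices are adjacent iff at least one of them lies in the `K_{r+2}` part,
or both lie in the second part with the same first coordinate. -/
def Gr (r : ℕ) : SimpleGraph (Fin (r + 2) ⊕ Fin (r + 1) × Fin 2) :=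
  SimpleGraph.fromRel fun a b =>
    a.isLeft = true ∨ b.isLeft = true ∨
      ∃ (i : Fin (r + 1)) (j k : Fin 2), a = Sum.inr (i, j) ∧ b = Sum.inr (i, k)

theorem inertia_aux {n κ : Type*} [Fintype n] [DecidableEq n] [Fintype κ] (A : Matrix n n ℝ)
    (hA : A.IsHermitian) (s : ℝ) (f : (κ → ℝ) →ₗ[ℝ] (n → ℝ))
    (hf : ∀ y, y ≠ 0 → 0 < s * (f y ⬝ᵥ (A.mulVec (f y)))) :
    Fintype.card κ ≤ (Finset.univ.filter fun v => 0 < s * hA.eigenvalues v).card := by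
  set U : Matrix n n ℝ := (hA.eigenvectorUnitary : Matrix n n ℝ) with hU
  have key : ∀ x : n → ℝ, x ⬝ᵥ A.mulVec x
      = ∑ i, hA.eigenvalues i * (Matrix.mulVec U.transpose x i) ^ 2 := by
    intro x
    have h : A = U * Matrix.diagonal hA.eigenvalues * U.transpose := by
      have := hA.spectral_theorem
      rw [Unitary.conjStarAlgAut_apply] at this
      exact this
    conv_lhs => rw [h]
    rw [← Matrix.mulVec_mulVec, ← Matrix.mulVec_mulVec, Matrix.dotProduct_mulVec,
      ← Matrix.mulVec_transpose]
    simp only [dotProduct, Matrix.mulVec_diagonal]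
    refine Finset.sum_congr rfl fun i _ => by ring
  let P := {v : n // 0 < s * hA.eigenvalues v}
  let g : (κ → ℝ) →ₗ[ℝ] (P → ℝ) :=
    (LinearMap.funLeft ℝ ℝ (Subtype.val : P → n)) ∘ₗ (Matrix.mulVecLin U.transpose) ∘ₗ f
  have hg : Function.Injective g := by
    rw [← LinearMap.ker_eq_bot, LinearMap.ker_eq_bot']
    intro y hy
    by_contra hne
    have h1 := hf y hne
    rw [key, Finset.mul_sum] at h1
    refine absurd h1 (not_lt.mpr (Finset.sum_nonpos fun i _ => ?_))
    by_cases hi : 0 < s * hA.eigenvalues i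
    · have : Matrix.mulVec U.transpose (f y) i = 0 := congrFun hy ⟨i, hi⟩
      rw [this]; simp
    · rw [← mul_assoc]
      exact mul_nonpos_of_nonpos_of_nonneg (not_lt.mp hi) (sq_nonneg _)
  have := LinearMap.finrank_le_finrank_of_injective hg
  rw [Module.finrank_fintype_fun_eq_card, Module.finrank_fintype_fun_eq_card,
    Fintype.card_subtype] at this
  exact this

theorem Gr_form (r : ℕ) (a : Fin (r + 2) → ℝ) (b : Fin (r + 1) × Fin 2 → ℝ) :
    (Sum.elim a b) ⬝ᵥ ((Gr r).adjMatrix ℝ).mulVec (Sum.elim a b) =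
      (∑ i, a i) ^ 2 - ∑ i, a i ^ 2 + 2 * (∑ i, a i) * (∑ i, (b (i, 0) + b (i, 1)))
        + ∑ i, 2 * b (i, 0) * b (i, 1) := by
  have h1 : ∀ i j, (Gr r).adjMatrix ℝ (Sum.inl i) (Sum.inl j) = 1 - if i = j then 1 else 0 := by
    intro i j
    by_cases h : i = j <;> simp [Gr, h]
  have h2 : ∀ i j, (Gr r).adjMatrix ℝ (Sum.inl i) (Sum.inr j) = 1 := by
    intro i j; simp [Gr]
  have h3 : ∀ i j, (Gr r).adjMatrix ℝ (Sum.inr i) (Sum.inl j) = 1 := by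
    intro i j; simp [Gr]
  have h4 : ∀ i j k l, (Gr r).adjMatrix ℝ (Sum.inr (i, k)) (Sum.inr (j, l)) =
      if i = j then (if k = l then 0 else 1) else 0 := by
    intro i j k l
    by_cases h : i = j <;> by_cases h' : k = l <;> simp [Gr, h, h']
    all_goals grind
  simp only [dotProduct, Matrix.mulVec, Fintype.sum_sum_type, Sum.elim_inl, Sum.elim_inr, h1, h2,
    h3, Fintype.sum_prod_type, h4, Fin.sum_univ_two]
  simp [sub_mul, mul_add, mul_sub, Finset.sum_add_distrib, ← Finset.sum_mul]
  simp only [← Finset.mul_sum, mul_assoc, pow_two, mul_comm (b (_, 1)) (b (_, 0))]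
  ring

/-- For every integer `r ≥ 1`, the graph `G_r` has inertia `(r+1, 0, 2r+3)`:
exactly `r+1` positive eigenvalues, no zero eigenvalue, and exactly `2r+3` negative
eigenvalues, counted with multiplicity. -/
theorem Gr_inertia (r : ℕ) (hr : 1 ≤ r) :
    (Finset.univ.filter fun v =>
        0 < (adjMatrix_isHermitian (Gr r)).eigenvalues v).card = r + 1 ∧
    (Finset.univ.filter fun v =>
        (adjMatrix_isHermitian (Gr r)).eigenvalues v = 0).card = 0 ∧
    (Finset.univ.filter fun v =>
        (adjMatrix_isHermitian (Gr r)).eigenvalues v < 0).card = 2 * r + 3 := by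
  have hpos := inertia_aux _ (adjMatrix_isHermitian (Gr r)) 1
    (κ := Fin (r + 1))
    { toFun := fun t => Sum.elim (fun _ => 0) (fun p => t p.1)
      map_add' := by intro x y; ext (i | i) <;> simp
      map_smul' := by intro c y; ext (i | i) <;> simp } (by
      intro y hy
      simp only [LinearMap.coe_mk, AddHom.coe_mk]
      rw [Gr_form]
      obtain ⟨i, hi⟩ := Function.ne_iff.mp hy
      have : 0 < ∑ i, 2 * y i * y i := by
        refine Finset.sum_pos' (fun i _ => by nlinarith [mul_self_nonneg (y i)])
          ⟨i, Finset.mem_univ _, ?_⟩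
        have := mul_self_pos.mpr hi
        nlinarith
      simpa using this)
  have hneg := inertia_aux _ (adjMatrix_isHermitian (Gr r)) (-1)
    (κ := Fin (r + 2) ⊕ Fin (r + 1))
    { toFun := fun t => Sum.elim (fun i => t (Sum.inl i))
        (fun p => -(∑ i, t (Sum.inl i)) + (if p.2 = 0 then 1 else -1) * t (Sum.inr p.1))
      map_add' := by
        intro x y; ext (i | i)
        · simp
        · simp only [Sum.elim_inr, Pi.add_apply, Finset.sum_add_distrib]; ring
      map_smul' := by
        intro c y; ext (i | i)
        · simp
        · simp only [Sum.elim_inr, Pi.smul_apply, smul_eq_mul, RingHom.id_apply, ← Finset.mul_sum]; ring } (by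
      intro y hy
      simp only [LinearMap.coe_mk, AddHom.coe_mk]
      rw [Gr_form]
      have hp : 0 < ∑ i, y (Sum.inl i) ^ 2 + ∑ i, y (Sum.inr i) ^ 2 := by
        rw [← Fintype.sum_sum_type (fun i => y i ^ 2)]
        obtain ⟨i, hi⟩ := Function.ne_iff.mp hy
        exact Finset.sum_pos' (fun i _ => sq_nonneg _)
          ⟨i, Finset.mem_univ _, sq_pos_of_ne_zero hi⟩
      have hn : 0 ≤ ∑ i, y (Sum.inr i) ^ 2 := Finset.sum_nonneg fun i _ => sq_nonneg _
      set S := ∑ i, y (Sum.inl i) with hS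
      have e1 : ∑ i : Fin (r + 1), ((-S + (if (0 : Fin 2) = 0 then 1 else -1) * y (Sum.inr i))
          + (-S + (if (1 : Fin 2) = 0 then 1 else -1) * y (Sum.inr i))) = -2 * (r + 1) * S := by
        rw [Finset.sum_congr rfl (g := fun _ => -2 * S) (fun i _ => by simp; ring)]
        simp; ring
      have e2 : ∑ i : Fin (r + 1), 2 * (-S + (if (0 : Fin 2) = 0 then 1 else -1) * y (Sum.inr i))
          * (-S + (if (1 : Fin 2) = 0 then 1 else -1) * y (Sum.inr i))
          = 2 * (r + 1) * S ^ 2 - 2 * ∑ i, y (Sum.inr i) ^ 2 := by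
        rw [Finset.sum_congr rfl (g := fun i => 2 * S ^ 2 - 2 * y (Sum.inr i) ^ 2)
          (fun i _ => by simp; ring)]
        simp [Finset.mul_sum]; ring
      rw [e1, e2]
      have : (0 : ℝ) ≤ r * S ^ 2 := by positivity
      nlinarith [sq_nonneg S])
  simp only [one_mul, neg_mul, neg_pos, Fintype.card_sum, Fintype.card_fin, Left.neg_pos_iff]
    at hpos hneg
  have htot : (Finset.univ.filter fun v =>
        0 < (adjMatrix_isHermitian (Gr r)).eigenvalues v).card +
    (Finset.univ.filter fun v =>
        (adjMatrix_isHermitian (Gr r)).eigenvalues v = 0).card +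
    (Finset.univ.filter fun v =>
        (adjMatrix_isHermitian (Gr r)).eigenvalues v < 0).card = 3 * r + 4 := by
    have hc : Fintype.card (Fin (r + 2) ⊕ Fin (r + 1) × Fin 2) = 3 * r + 4 := by
      simp; ring
    rw [← hc, ← Finset.card_univ, Finset.card_eq_sum_ones Finset.univ, Finset.card_filter,
      Finset.card_filter, Finset.card_filter, ← Finset.sum_add_distrib, ← Finset.sum_add_distrib]
    refine Finset.sum_congr rfl fun v _ => ?_
    rcases lt_trichotomy ((adjMatrix_isHermitian (Gr r)).eigenvalues v) 0 with h | h | h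
    · simp [h, h.ne, h.le]
    · simp [h]
    · simp [h, h.ne', h.le]
  omega
end

section
/- For every integer r ≥ 1, the multiplicity of −1 as an eigenvalue of the adjacency matrix of G_r is 2(r+1). -/
open scoped Classical

def Grφ (r : ℕ) : ((Fin (r + 2) ⊕ Fin (r + 1) × Fin 2) → ℝ) →ₗ[ℝ] (ℝ × (Fin (r+1) → ℝ)) where
  toFun x := (∑ i, x (Sum.inl i), fun i => x (Sum.inr (i,0)) + x (Sum.inr (i,1)))
  map_add' x y := by
    ext
    · simp [Finset.sum_add_distrib]
    · simp; ring
  map_smul' c x := by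
    ext
    · simp [Finset.mul_sum]
    · simp; ring

lemma Grφ_surj (r : ℕ) : Function.Surjective (Grφ r) := by
  rintro ⟨a, f⟩
  refine ⟨Sum.elim (fun i => if i = 0 then a else 0) (fun p => if p.2 = 0 then f p.1 else 0), ?_⟩
  simp [Grφ]

lemma Gr_entry_l (r : ℕ) (a) (b) : ((Gr r).adjMatrix ℝ + 1) (Sum.inl a) b = 1 := by
  by_cases h : Sum.inl a = b
  · subst h; simp
  · simp [Matrix.add_apply, Matrix.one_apply, SimpleGraph.adjMatrix_apply, Gr, h]

lemma Gr_entry_rl (r : ℕ) (a) (b) : ((Gr r).adjMatrix ℝ + 1) (Sum.inr a) (Sum.inl b) = 1 := by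
  simp [Matrix.add_apply, Matrix.one_apply, SimpleGraph.adjMatrix_apply, Gr]

lemma Gr_entry_rr (r : ℕ) (a b : Fin (r+1) × Fin 2) :
    ((Gr r).adjMatrix ℝ + 1) (Sum.inr a) (Sum.inr b) = if a.1 = b.1 then 1 else 0 := by
  obtain ⟨i, j⟩ := a
  obtain ⟨k, l⟩ := b
  by_cases h : i = k
  · subst h
    by_cases h2 : j = l
    · subst h2; simp
    · simp [Matrix.add_apply, Matrix.one_apply, SimpleGraph.adjMatrix_apply, Gr, h2]
      intro _
      exact ⟨i, by simp; omega, by simp; omega⟩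
  · have h' : ¬ k = i := fun e => h e.symm
    simp [Matrix.add_apply, Matrix.one_apply, SimpleGraph.adjMatrix_apply, Gr, h]
    grind

lemma Gr_ker (r : ℕ) (hr : 1 ≤ r) :
    LinearMap.ker (Matrix.toLin' ((Gr r).adjMatrix ℝ + 1)) = LinearMap.ker (Grφ r) := by
  ext x
  have hl : ∀ a, (((Gr r).adjMatrix ℝ + 1).mulVec x) (Sum.inl a) =
      ∑ i, x (Sum.inl i) + ∑ i, (x (Sum.inr (i,0)) + x (Sum.inr (i,1))) := by
    intro a
    simp only [Matrix.mulVec, dotProduct, Gr_entry_l, Fintype.sum_sum_type, one_mul,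
      Fintype.sum_prod_type, Fin.sum_univ_two]
  have hrr : ∀ a, (((Gr r).adjMatrix ℝ + 1).mulVec x) (Sum.inr a) =
      ∑ i, x (Sum.inl i) + (x (Sum.inr (a.1,0)) + x (Sum.inr (a.1,1))) := by
    intro a
    simp only [Matrix.mulVec, dotProduct, Gr_entry_rl, Gr_entry_rr, Fintype.sum_sum_type, one_mul,
      Fintype.sum_prod_type, Fin.sum_univ_two, ite_mul, zero_mul]
    simp [Finset.sum_add_distrib]
  rw [LinearMap.mem_ker, LinearMap.mem_ker, Matrix.toLin'_apply]
  constructor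
  · intro h
    have h1 := hl 0
    have h2 := fun i => hrr (i, 0)
    simp only [h, Pi.zero_apply] at h1 h2
    have h3 : ∀ i, x (Sum.inr (i,0)) + x (Sum.inr (i,1)) = - ∑ i, x (Sum.inl i) := by
      intro i; linarith [h2 i]
    simp only [h3, Finset.sum_const, Finset.card_univ, Fintype.card_fin, nsmul_eq_mul] at h1
    have hr' : (r:ℝ) ≠ 0 := by positivity
    have h4 : ∑ i, x (Sum.inl i) = 0 := by
      apply mul_left_cancel₀ hr'
      push_cast at h1
      linarith
    ext i
    · simpa [Grφ] using h4
    · simpa [Grφ, h4] using h3 i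
  · intro h
    have h1 : ∑ i, x (Sum.inl i) = 0 := congrArg Prod.fst h
    have h2 : ∀ i, x (Sum.inr (i,0)) + x (Sum.inr (i,1)) = 0 :=
      fun i => congrFun (congrArg Prod.snd h) i
    ext (a | a)
    · simp [hl, h1, h2]
    · simp [hrr, h1, h2]

theorem Gr_mult_neg_one (r : ℕ) (hr : 1 ≤ r) :
    Module.finrank ℝ (LinearMap.ker (Matrix.toLin' ((Gr r).adjMatrix ℝ + 1))) =
      2 * (r + 1) := by
  rw [Gr_ker r hr]
  have := LinearMap.finrank_range_add_finrank_ker (Grφ r)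
  rw [LinearMap.range_eq_top.2 (Grφ_surj r)] at this
  simp at this
  omega
end

section
/- For every integer r ≥ 1, the multiplicity of 1 as an eigenvalue of the adjacency matrix of G_r is exactly r. -/
open scoped Classical

def GrL (r : ℕ) : (Fin (r + 1) → ℝ) →ₗ[ℝ] (Fin (r + 2) ⊕ Fin (r + 1) × Fin 2 → ℝ) where
  toFun z := Sum.elim (fun _ => 0) (fun p => z p.1)
  map_add' a b := by ext v; cases v <;> simp
  map_smul' a b := by ext v; cases v <;> simp

def GrS (r : ℕ) : (Fin (r + 1) → ℝ) →ₗ[ℝ] ℝ where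
  toFun z := ∑ i, z i
  map_add' a b := by simp [Finset.sum_add_distrib]
  map_smul' a b := by simp [Finset.mul_sum]

theorem GrS_ker (r : ℕ) : Module.finrank ℝ (LinearMap.ker (GrS r)) = r := by
  have h := LinearMap.finrank_range_add_finrank_ker (GrS r)
  have hs : LinearMap.range (GrS r) = ⊤ := by
    rw [LinearMap.range_eq_top]
    intro c
    exact ⟨Pi.single 0 c, by simp [GrS]⟩
  rw [hs] at h
  simp at h
  omega

theorem Gr_inl (r : ℕ) (i : Fin (r + 2)) (w) : (Gr r).Adj (Sum.inl i) w ↔ w ≠ Sum.inl i := by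
  simp only [Gr, SimpleGraph.fromRel_adj, Sum.isLeft_inl, true_or, and_true]
  exact ne_comm

theorem Gr_inr_inl (r : ℕ) (p) (i : Fin (r + 2)) : (Gr r).Adj (Sum.inr p) (Sum.inl i) := by
  simp [Gr, SimpleGraph.fromRel_adj]

theorem Gr_inr_inr (r : ℕ) (p q : Fin (r + 1) × Fin 2) :
    (Gr r).Adj (Sum.inr p) (Sum.inr q) ↔ q = (p.1, 1 - p.2) := by
  obtain ⟨i, j⟩ := p
  obtain ⟨k, l⟩ := q
  simp only [Gr, SimpleGraph.fromRel_adj]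
  fin_cases j <;> fin_cases l <;> simp <;> grind

theorem Gr_mem (r : ℕ) (x : Fin (r + 2) ⊕ Fin (r + 1) × Fin 2 → ℝ) :
    x ∈ LinearMap.ker (Matrix.toLin' ((Gr r).adjMatrix ℝ - 1)) ↔
      (∀ i, (∑ w, x w) - x (Sum.inl i) = x (Sum.inl i)) ∧
      (∀ p : Fin (r + 1) × Fin 2,
        (∑ i, x (Sum.inl i)) + x (Sum.inr (p.1, 1 - p.2)) = x (Sum.inr p)) := by
  rw [LinearMap.mem_ker, Matrix.toLin'_apply, Matrix.sub_mulVec, Matrix.one_mulVec, sub_eq_zero,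
    funext_iff, Sum.forall]
  refine and_congr (forall_congr' fun i => ?_) (forall_congr' fun p => ?_)
  · have : ((Gr r).adjMatrix ℝ).mulVec x (Sum.inl i) = (∑ w, x w) - x (Sum.inl i) := by
      simp only [Matrix.mulVec, dotProduct, SimpleGraph.adjMatrix_apply, Gr_inl, ite_mul, one_mul,
        zero_mul]
      rw [← Finset.sum_erase_eq_sub (Finset.mem_univ _), ← Finset.sum_filter]
      congr 1
      ext w; simp
    rw [this]
  · have : ((Gr r).adjMatrix ℝ).mulVec x (Sum.inr p) =
        (∑ i, x (Sum.inl i)) + x (Sum.inr (p.1, 1 - p.2)) := by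
      simp only [Matrix.mulVec, dotProduct, SimpleGraph.adjMatrix_apply, Fintype.sum_sum_type,
        Gr_inr_inl, Gr_inr_inr, ite_mul, one_mul, zero_mul, if_true, Finset.sum_ite_eq',
        Finset.sum_ite_eq, Finset.mem_univ]
    rw [this]

theorem Gr_ker_s8 (r : ℕ) : LinearMap.ker (Matrix.toLin' ((Gr r).adjMatrix ℝ - 1)) =
    (LinearMap.ker (GrS r)).map (GrL r) := by
  ext x
  rw [Gr_mem, Submodule.mem_map]
  constructor
  · rintro ⟨h1, h2⟩
    have hS : ∑ i, x (Sum.inl i) = 0 := by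
      have a := h2 (0, 0)
      have b := h2 (0, 1)
      simp at a b
      linarith
    have hc : ∀ i, x (Sum.inl i) = (∑ w, x w) / 2 := fun i => by linarith [h1 i]
    have hT : ∑ w, x w = 0 := by
      rw [Finset.sum_congr rfl (fun i _ => hc i)] at hS
      simp at hS
      rcases hS with h | h
      · exfalso
        have : (0 : ℝ) ≤ r := Nat.cast_nonneg r
        linarith
      · simpa using h
    have h0 : ∀ i, x (Sum.inl i) = 0 := fun i => by rw [hc, hT]; simp
    have h01 : ∀ i, x (Sum.inr (i, 1)) = x (Sum.inr (i, 0)) := fun i => by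
      have a := h2 (i, 0)
      rw [hS] at a
      simpa using a
    refine ⟨fun i => x (Sum.inr (i, 0)), ?_, ?_⟩
    · rw [LinearMap.mem_ker]
      change ∑ i, x (Sum.inr (i, 0)) = 0
      rw [Fintype.sum_sum_type, hS, Fintype.sum_prod_type] at hT
      simp only [Fin.sum_univ_two, h01, ← two_mul, ← Finset.mul_sum] at hT
      linarith
    · ext v
      rcases v with i | ⟨i, j⟩
      · simp [GrL, h0]
      · fin_cases j <;> simp [GrL, h01]
  · rintro ⟨z, hz, rfl⟩
    have hz' : ∑ i, z i = 0 := hz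
    simp [GrL, Fintype.sum_prod_type, ← two_mul, ← Finset.mul_sum, hz']

/-- For every integer `r ≥ 1`, the multiplicity of `1` as an adjacency eigenvalue of
`G_r` (the dimension of the kernel of `A - I`) is exactly `r`. -/
theorem Gr_mult_one (r : ℕ) (hr : 1 ≤ r) :
    Module.finrank ℝ (LinearMap.ker (Matrix.toLin' ((Gr r).adjMatrix ℝ - 1))) = r := by
  have hi : Function.Injective (GrL r) := by
    intro a b h
    ext i
    simpa [GrL] using congrFun h (Sum.inr (i, 0))
  rw [Gr_ker_s8, ← (Submodule.equivMapOfInjective (GrL r) hi _).finrank_eq, GrS_ker]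
end

section
/- For every integer r ≥ 1, the largest eigenvalue of the adjacency matrix of G_r is 2r + 3. -/
open scoped Classical

def GrVec (r : ℕ) : Fin (r + 2) ⊕ Fin (r + 1) × Fin 2 → ℝ :=
  Sum.elim (fun _ => 2 * ((r : ℝ) + 1)) (fun _ => (r : ℝ) + 2)

lemma GrVec_pos (r : ℕ) (a) : 0 < GrVec r a := by
  rcases a with a | a <;> simp only [GrVec, Sum.elim_inl, Sum.elim_inr] <;> positivity

lemma Gr_ll (r : ℕ) (a b) : (Gr r).Adj (Sum.inl a) (Sum.inl b) ↔ a ≠ b := by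
  simp [Gr]

lemma Gr_lr (r : ℕ) (a b) : (Gr r).Adj (Sum.inl a) (Sum.inr b) ↔ True := by
  simp [Gr]

lemma Gr_rl (r : ℕ) (a b) : (Gr r).Adj (Sum.inr a) (Sum.inl b) ↔ True := by
  simp [Gr]

lemma Gr_rr (r : ℕ) (i i' : Fin (r + 1)) (j j' : Fin 2) :
    (Gr r).Adj (Sum.inr (i, j)) (Sum.inr (i', j')) ↔ (i = i' ∧ j ≠ j') := by
  simp only [Gr, SimpleGraph.fromRel_adj]
  constructor
  · rintro ⟨h, h'⟩
    simp at h h'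
    grind
  · rintro ⟨rfl, h⟩
    simp [h]

lemma Gr_mulVec (r : ℕ) (a) :
    ∑ b, (Gr r).adjMatrix ℝ a b * GrVec r b = (2 * (r : ℝ) + 3) * GrVec r a := by
  rcases a with a | ⟨i, j⟩
  · simp only [Fintype.sum_sum_type, SimpleGraph.adjMatrix_apply, Gr_ll, Gr_lr, GrVec,
      Sum.elim_inl, Sum.elim_inr]
    have : ∀ b : Fin (r + 2), (if a ≠ b then (1 : ℝ) else 0) = 1 - if a = b then 1 else 0 := by
      intro b; split_ifs <;> simp_all
    simp only [this, ← Finset.sum_mul, Finset.sum_sub_distrib]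
    simp
    ring
  · simp only [Fintype.sum_sum_type, Fintype.sum_prod_type, SimpleGraph.adjMatrix_apply, Gr_rl,
      Gr_rr, GrVec, Sum.elim_inl, Sum.elim_inr]
    have : ∀ i' : Fin (r + 1), ∑ j' : Fin 2, (if i = i' ∧ j ≠ j' then (1 : ℝ) else 0) * ((r : ℝ) + 2)
        = if i = i' then (r : ℝ) + 2 else 0 := by
      intro i'
      by_cases h : i = i'
      · fin_cases j <;> simp [h]
      · simp [h]
    simp only [this]
    simp
    ring

/-- For every integer `r ≥ 1`, the largest adjacency eigenvalue of `G_r` is `2r + 3`. -/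
theorem Gr_largest_eigenvalue (r : ℕ) (hr : 1 ≤ r) :
    IsGreatest {μ : ℝ | Module.End.HasEigenvalue (Matrix.toLin' ((Gr r).adjMatrix ℝ)) μ}
      (2 * (r : ℝ) + 3) := by
  constructor
  · apply Module.End.hasEigenvalue_of_hasEigenvector (x := GrVec r)
    refine ⟨Module.End.mem_eigenspace_iff.2 ?_, ?_⟩
    · funext a
      simpa [Matrix.toLin'_apply, Matrix.mulVec, dotProduct] using Gr_mulVec r a
    · intro h
      have := GrVec_pos r (Sum.inl 0)
      rw [h] at this
      simp at this
  · rintro μ hμ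
    obtain ⟨v, hv⟩ := Module.End.HasEigenvalue.exists_hasEigenvector hμ
    have h0 := hv.2
    have hA : ∀ a, ∑ b, (Gr r).adjMatrix ℝ a b * v b = μ * v a := fun a => by
      have := congrFun (Module.End.mem_eigenspace_iff.1 hv.1) a
      rw [Matrix.toLin'_apply] at this
      exact this
    obtain ⟨a, ha⟩ := Finite.exists_max (fun a => |v a| / GrVec r a)
    have hpa := GrVec_pos r a
    have hb : ∀ b, |v b| ≤ |v a| / GrVec r a * GrVec r b := fun b =>
      (div_le_iff₀ (GrVec_pos r b)).1 (ha b)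
    have hva : 0 < |v a| := by
      by_contra hn
      have hz : |v a| = 0 := le_antisymm (not_lt.1 hn) (abs_nonneg _)
      apply h0
      funext b
      have := hb b
      rw [hz] at this
      simpa using this
    have key : |μ| * |v a| ≤ (2 * (r : ℝ) + 3) * |v a| := by
      calc |μ| * |v a| = |∑ b, (Gr r).adjMatrix ℝ a b * v b| := by rw [hA, abs_mul]
        _ ≤ ∑ b, |(Gr r).adjMatrix ℝ a b * v b| := Finset.abs_sum_le_sum_abs _ _
        _ ≤ ∑ b, |v a| / GrVec r a * ((Gr r).adjMatrix ℝ a b * GrVec r b) := by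
          apply Finset.sum_le_sum
          intro b _
          have hn : 0 ≤ (Gr r).adjMatrix ℝ a b := by
            rw [SimpleGraph.adjMatrix_apply]; split_ifs <;> simp
          rw [abs_mul, abs_of_nonneg hn]
          calc _ ≤ _ := mul_le_mul_of_nonneg_left (hb b) hn
            _ = _ := by ring
        _ = _ := by
          rw [← Finset.mul_sum, Gr_mulVec]
          field_simp
    exact (le_abs_self μ).trans (le_of_mul_le_mul_right key hva)
end

section
/- For every integer r ≥ 1, the smallest eigenvalue of the adjacency matrix of G_r is −(r + 1). -/
open scoped Classical

theorem Gr_mul_inl (r : ℕ) (v : Fin (r + 2) ⊕ Fin (r + 1) × Fin 2 → ℝ) (a : Fin (r + 2)) :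
    ((Gr r).adjMatrix ℝ).mulVec v (Sum.inl a)
      = (∑ b, v (Sum.inl b)) - v (Sum.inl a) + ∑ p, v (Sum.inr p) := by
  have h1 : ∀ b : Fin (r + 2), (Gr r).adjMatrix ℝ (Sum.inl a) (Sum.inl b) * v (Sum.inl b)
      = v (Sum.inl b) - if a = b then v (Sum.inl b) else 0 := by
    intro b
    by_cases h : a = b <;> simp [SimpleGraph.adjMatrix_apply, Gr, h]
  have h2 : ∀ p, (Gr r).adjMatrix ℝ (Sum.inl a) (Sum.inr p) * v (Sum.inr p) = v (Sum.inr p) := by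
    intro p
    simp [SimpleGraph.adjMatrix_apply, Gr]
  simp only [Matrix.mulVec, dotProduct, Fintype.sum_sum_type, h1, h2, Finset.sum_sub_distrib]
  simp

theorem Gr_mul_inr (r : ℕ) (v : Fin (r + 2) ⊕ Fin (r + 1) × Fin 2 → ℝ) (i : Fin (r + 1))
    (j : Fin 2) :
    ((Gr r).adjMatrix ℝ).mulVec v (Sum.inr (i, j))
      = (∑ b, v (Sum.inl b)) + v (Sum.inr (i, 1 - j)) := by
  have h1 : ∀ b : Fin (r + 2), (Gr r).adjMatrix ℝ (Sum.inr (i, j)) (Sum.inl b) * v (Sum.inl b)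
      = v (Sum.inl b) := by
    intro b
    simp [SimpleGraph.adjMatrix_apply, Gr]
  have h2 : ∀ p, (Gr r).adjMatrix ℝ (Sum.inr (i, j)) (Sum.inr p) * v (Sum.inr p)
      = if (i, 1 - j) = p then v (Sum.inr p) else 0 := by
    rintro ⟨k, l⟩
    by_cases h : i = k
    · subst h
      fin_cases j <;> fin_cases l <;> simp [SimpleGraph.adjMatrix_apply, Gr]
    · have h' : ¬ k = i := fun e => h e.symm
      simp [SimpleGraph.adjMatrix_apply, Gr, h]
      intro hh
      grind
  simp only [Matrix.mulVec, dotProduct, Fintype.sum_sum_type, h1, h2]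
  simp

/-- For every integer `r ≥ 1`, the smallest adjacency eigenvalue of `G_r` is `-(r + 1)`. -/
theorem Gr_smallest_eigenvalue (r : ℕ) (hr : 1 ≤ r) :
    IsLeast {μ : ℝ | Module.End.HasEigenvalue (Matrix.toLin' ((Gr r).adjMatrix ℝ)) μ}
      (-((r : ℝ) + 1)) := by
  have hr' : (1 : ℝ) ≤ r := by exact_mod_cast hr
  constructor
  · refine Module.End.hasEigenvalue_of_hasEigenvector
      (x := Sum.elim (fun _ => (1 : ℝ)) (fun _ => -1)) ⟨?_, ?_⟩
    · rw [Module.End.mem_eigenspace_iff, Matrix.toLin'_apply]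
      ext x
      rcases x with a | ⟨i, j⟩
      · rw [Gr_mul_inl]
        simp
        ring
      · rw [Gr_mul_inr]
        simp
        ring
    · intro h
      have := congrFun h (Sum.inl 0)
      simp at this
  · intro μ hμ
    obtain ⟨v, hv, hv0⟩ := Module.End.HasEigenvalue.exists_hasEigenvector hμ
    rw [Module.End.mem_eigenspace_iff, Matrix.toLin'_apply] at hv
    by_contra hlt
    push Not at hlt
    have hx : ∀ a, (∑ b, v (Sum.inl b)) - v (Sum.inl a) + ∑ p, v (Sum.inr p)
        = μ * v (Sum.inl a) := by
      intro a
      rw [← Gr_mul_inl, hv]; simp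
    have hy : ∀ i j, (∑ b, v (Sum.inl b)) + v (Sum.inr (i, 1 - j)) = μ * v (Sum.inr (i, j)) := by
      intro i j
      rw [← Gr_mul_inr, hv]; simp
    generalize hS : (∑ b, v (Sum.inl b)) = S at hx hy
    generalize hT : (∑ p, v (Sum.inr p)) = T at hx
    have hm1 : μ + 1 ≠ 0 := by intro h; linarith
    have hm2 : μ - 1 ≠ 0 := by intro h; linarith
    have hx' : ∀ a, v (Sum.inl a) = (S + T) / (μ + 1) := by
      intro a
      rw [eq_div_iff hm1]
      linarith [hx a]
    have hy' : ∀ p, v (Sum.inr p) = S / (μ - 1) := by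
      rintro ⟨i, j⟩
      have e0 := hy i 0
      have e1 := hy i 1
      simp at e0 e1
      have e : v (Sum.inr (i, 0)) = v (Sum.inr (i, 1)) := by
        apply mul_left_cancel₀ hm1
        linarith
      rw [eq_div_iff hm2]
      fin_cases j
      · simp; rw [← e] at e0; linarith
      · simp; rw [e] at e1; linarith
    have hS' := hS
    have hT' := hT
    simp only [hx', Finset.sum_const, Finset.card_univ, Fintype.card_fin, nsmul_eq_mul] at hS'
    simp only [hy', Finset.sum_const, Finset.card_univ, Fintype.card_fin, Fintype.card_prod,
      nsmul_eq_mul] at hT'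
    push_cast at hS' hT'
    field_simp at hS' hT'
    have hprod : S * ((μ - (2 * r + 3)) * (μ + (r + 1))) = 0 := by
      linear_combination (-(μ - 1)) * hS' - ((r : ℝ) + 2) * hT'
    have hS0 : S = 0 := by
      rcases mul_eq_zero.mp hprod with h | h
      · exact h
      · rcases mul_eq_zero.mp h with h | h <;> exfalso <;> linarith
    have hT0 : T = 0 := by
      rw [← hT]; simp [hy', hS0]
    apply hv0
    ext x
    rcases x with a | p
    · simp [hx', hS0, hT0]
    · simp [hy', hS0]
end

section
/- For every integer r ≥ 1, the characteristic polynomial of the adjacency matrix of G_r is (x − (2r+3)) · (x + (r+1)) · (x − 1)^r · (x + 1)^{2r+2}; equivalently, the spectrum of G_r consists of 2r+3 with multiplicity 1, 1 with multiplicity r, −1 with multiplicity 2r+2, and −(r+1) with multiplicity 1. -/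
open scoped Classical
open Polynomial

def GrP (r : ℕ) : Matrix (Fin (r + 2) ⊕ Fin (r + 1) × Fin 2) (Unit ⊕ Fin (r + 1)) ℝ :=
  fun v c => if Sum.map (fun _ => ()) Prod.fst v = c then 1 else 0

def GrQ (r : ℕ) : Matrix (Unit ⊕ Fin (r + 1)) (Fin (r + 2) ⊕ Fin (r + 1) × Fin 2) ℝ :=
  fun c v => if c.isLeft = true ∨ v.isLeft = true ∨ Sum.map (fun _ => ()) Prod.fst v = c then 1 else 0

lemma Gr_factor (r : ℕ) :
    (Gr r).adjMatrix ℝ = GrP r * GrQ r - Matrix.scalar _ (1 : ℝ) := by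
  ext a b
  rw [Matrix.sub_apply, Matrix.mul_apply]
  simp only [GrP, ite_mul, one_mul, zero_mul, Finset.sum_ite_eq, Finset.mem_univ, if_true]
  rw [SimpleGraph.adjMatrix_apply, Matrix.scalar_apply, Matrix.diagonal_apply]
  by_cases h : a = b
  · subst h
    simp [GrQ]
  · rcases a with a | ⟨i, j⟩ <;> rcases b with b | ⟨k, l⟩
    · simp [GrQ, Gr, h]
    · simp [GrQ, Gr]
    · simp [GrQ, Gr]
    · have hadj : (Gr r).Adj (Sum.inr (i, j)) (Sum.inr (k, l)) ↔ k = i := by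
        rw [Gr, SimpleGraph.fromRel_adj]
        constructor
        · rintro ⟨_, (h | h | ⟨x, y, z, h1, h2⟩) | (h | h | ⟨x, y, z, h1, h2⟩)⟩ <;> simp_all
        · rintro rfl
          exact ⟨h, Or.inl (Or.inr (Or.inr ⟨k, j, l, rfl, rfl⟩))⟩
      rw [if_neg h]
      simp only [hadj]
      simp [GrQ]

lemma Gr_quot (r : ℕ) :
    GrQ r * GrP r = Matrix.fromBlocks (Matrix.of fun _ _ => (r : ℝ) + 2) (Matrix.of fun _ _ => 2)
      (Matrix.of fun _ _ => (r : ℝ) + 2) (Matrix.diagonal fun _ => 2) := by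
  ext a b
  rw [Matrix.mul_apply, Fintype.sum_sum_type, Fintype.sum_prod_type]
  rcases a with a | a <;> rcases b with b | b <;>
    simp [GrP, GrQ, Matrix.diagonal_apply]
  simp [eq_comm]

lemma Gr_quot_charpoly (r : ℕ) :
    (GrQ r * GrP r).charpoly = (X - C (2 * (r : ℝ) + 4)) * (X + C (r : ℝ)) * (X - 2) ^ r := by
  apply Polynomial.eq_of_infinite_eval_eq
  apply (Set.finite_singleton (2:ℝ)).infinite_compl.mono
  intro x hx
  have hx : x - 2 ≠ 0 := sub_ne_zero.2 hx
  have hm : (Matrix.scalar (Unit ⊕ Fin (r + 1)) x - GrQ r * GrP r) =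
      Matrix.fromBlocks (Matrix.of fun _ _ => x - ((r : ℝ) + 2)) (Matrix.of fun _ _ => -2)
      (Matrix.of fun _ _ => - ((r : ℝ) + 2)) (Matrix.diagonal fun _ => x - 2) := by
    rw [Gr_quot]
    ext a b
    rcases a with a | a <;> rcases b with b | b <;> simp [Matrix.diagonal_apply]
    split_ifs <;> simp
  let : Invertible (Matrix.diagonal fun _ : Fin (r+1) => x - 2) :=
    ⟨Matrix.diagonal fun _ => (x-2)⁻¹, by simp [hx], by simp [hx]⟩
  have hi : ⅟(Matrix.diagonal fun _ : Fin (r+1) => x - 2) = Matrix.diagonal fun _ => (x-2)⁻¹ := rfl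
  simp only [Set.mem_ofPred_eq]
  rw [Matrix.eval_charpoly, hm, Matrix.det_fromBlocks₂₂, hi]
  simp [Matrix.mul_apply, Matrix.diagonal_apply]
  field_simp
  ring

/-- For every integer `r ≥ 1`, the characteristic polynomial of the adjacency matrix of
`G_r` is `(x - (2r+3)) (x + (r+1)) (x - 1)^r (x + 1)^{2r+2}`; that is, the spectrum
consists of `2r+3` (multiplicity 1), `1` (multiplicity `r`), `-1` (multiplicity
`2r+2`) and `-(r+1)` (multiplicity 1). -/
theorem Gr_charpoly (r : ℕ) (hr : 1 ≤ r) :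
    ((Gr r).adjMatrix ℝ).charpoly =
      (X - C (2 * (r : ℝ) + 3)) * (X + C ((r : ℝ) + 1)) *
        (X - 1) ^ r * (X + 1) ^ (2 * r + 2) := by
  have h := Matrix.charpoly_mul_comm_of_le (GrP r) (GrQ r) (by simp; omega)
  rw [Gr_factor, Matrix.charpoly_sub_scalar, h, Gr_quot_charpoly]
  have e : Fintype.card (Fin (r + 2) ⊕ Fin (r + 1) × Fin 2) - Fintype.card (Unit ⊕ Fin (r + 1))
    = 2 * r + 2 := by simp; omega
  rw [e]
  simp
  have e2 : (X + 1 - 2 : ℝ[X]) = X - 1 := by ring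
  rw [e2]
  have : (C 4 : ℝ[X]) = C 3 + 1 := by rw [← C_1, ← C_add]; norm_num
  rw [this]
  ring
end

section
/- Let y be a real number with y > 1 and let (x_j)_{j ≥ 0} be the real sequence defined by x_0 = y and x_{j+1} = (x_j · y − 1)/(x_j + y − 2). Then for every j ≥ 0 one has x_j = (y + j)/(j + 1); in particular, for every j ≥ 0, x_j + y − 2 = ((j+2)/(j+1))(y − 1) > 0, so the recursion is well defined. -/
/-- Closed form for the diagonal values when processing leaves with common parent `⊗`
all carrying the same value `y > 1`: if `x 0 = y` and
`x (j+1) = (x j * y - 1)/(x j + y - 2)`, then `x j = (y + j)/(j + 1)`; in particular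
`x j + y - 2 = ((j+2)/(j+1)) * (y - 1) > 0`, so the recursion is well defined. -/
theorem join_recursion_closed_form (y : ℝ) (hy : 1 < y) (x : ℕ → ℝ) (hx0 : x 0 = y)
    (hrec : ∀ j : ℕ, x (j + 1) = (x j * y - 1) / (x j + y - 2)) :
    ∀ j : ℕ, x j = (y + j) / (j + 1) ∧
      x j + y - 2 = ((j + 2) / (j + 1)) * (y - 1) ∧ 0 < x j + y - 2 := by
  have hy1 : 0 < y - 1 := by linarith
  have key : ∀ j : ℕ, x j = (y + j) / (j + 1) →
      x j + y - 2 = (((j : ℝ) + 2) / (j + 1)) * (y - 1) := by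
    intro j h
    have hj : (j : ℝ) + 1 ≠ 0 := by positivity
    rw [h]
    field_simp
    ring
  have main : ∀ j : ℕ, x j = (y + j) / (j + 1) := by
    intro j
    induction j with
    | zero => simp [hx0]
    | succ j ih =>
      have hj : (j : ℝ) + 1 ≠ 0 := by positivity
      have hj2 : (j : ℝ) + 2 ≠ 0 := by positivity
      have hj3 : (j : ℝ) + 1 + 1 ≠ 0 := by positivity
      have hn : x j * y - 1 = (y - 1) * (y + 1 + j) / (j + 1) := by
        rw [ih]
        field_simp
        ring
      have hy2 : y - 1 ≠ 0 := hy1.ne'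
      rw [hrec, key j ih, hn]
      push_cast
      rw [div_eq_div_iff (by positivity) hj3]
      field_simp
      ring
  intro j
  refine ⟨main j, key j (main j), ?_⟩
  rw [key j (main j)]
  positivity
end
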